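/- Let X be a compact metric space, f : X → X continuous, C a chain component of f, δ > 0, and g = f|_C. Then any x, y ∈ C with d(x,y) ≤ δ satisfy x ∼_{C,δ} y. Consequently, for every δ-chain (x_i)_{i=0}^k of g, one has g(x_i) ∼_{C,δ} x_{i+1} for each 0 ≤ i ≤ k−1, and hence x_i ∼_{C,δ} g^i(x_0) for every 0 ≤ i ≤ k. -/

import Mathlib

open Filter Metric Set Topology

section Defs

variable {X : Type*} [MetricSpace X]

/-- A δ-chain of `f` of length `k` (with `k ≥ 1`) within the set `C`, from `x` to `y`. -/
def ChainIn (f : X → X) (C : Set X) (δ : ℝ) (k : ℕ) (x y : X) : Prop :=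
  1 ≤ k ∧ ∃ c : ℕ → X, c 0 = x ∧ c k = y ∧ (∀ i ≤ k, c i ∈ C) ∧
    ∀ i < k, dist (f (c i)) (c (i + 1)) ≤ δ

/-- `x → y` : for every `δ > 0` there is a `δ`-chain of `f` from `x` to `y`. -/
def ChainReach (f : X → X) (x y : X) : Prop :=
  ∀ δ > 0, ∃ k, ChainIn f Set.univ δ k x y

/-- `x` is chain recurrent for `f`. -/
def ChainRecurrent (f : X → X) (x : X) : Prop := ChainReach f x x

/-- `C` is a chain component of `f`: an equivalence class of the relation `↔`
on the set of chain recurrent points. -/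
def IsChainComponent (f : X → X) (C : Set X) : Prop :=
  ∃ x, ChainRecurrent f x ∧
    C = {y | ChainRecurrent f y ∧ ChainReach f x y ∧ ChainReach f y x}

/-- The set of lengths of δ-cycles of `f` restricted to `C`. -/
def cycleLengths (f : X → X) (C : Set X) (δ : ℝ) : Set ℕ :=
  {k | ∃ x ∈ C, ChainIn f C δ k x x}

/-- The greatest common divisor of a set of natural numbers
(the greatest natural number dividing every element). -/
noncomputable def setGcd (S : Set ℕ) : ℕ := sSup {d | ∀ k ∈ S, d ∣ k}

/-- `x ∼_{C,δ} y` : there is a δ-chain of `f|_C` from `x` to `y` whose length is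
divisible by `m(C,δ)`, the gcd of the lengths of all δ-cycles of `f|_C`. -/
def SimCd (f : X → X) (C : Set X) (δ : ℝ) (x y : X) : Prop :=
  ∃ k, setGcd (cycleLengths f C δ) ∣ k ∧ ChainIn f C δ k x y

/-- `x ∼_C y` : `x ∼_{C,δ} y` for all `δ > 0`. -/
def SimC (f : X → X) (C : Set X) (x y : X) : Prop :=
  ∀ δ > 0, SimCd f C δ x y

/-- `𝒟(C,δ)` : the set of equivalence classes of `∼_{C,δ}`. -/
def DClassesd (f : X → X) (C : Set X) (δ : ℝ) : Set (Set X) :=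
  {D | ∃ x ∈ C, D = {y ∈ C | SimCd f C δ x y}}

/-- `𝒟(C)` : the set of equivalence classes of `∼_C`. -/
def DClasses (f : X → X) (C : Set X) : Set (Set X) :=
  {D | ∃ x ∈ C, D = {y ∈ C | SimC f C x y}}

/-- `W^s(C) = {x : lim_{i→∞} d(f^i(x), C) = 0}`. -/
def wStable (f : X → X) (C : Set X) : Set X :=
  {x | Tendsto (fun i => infDist (f^[i] x) C) atTop (nhds 0)}

/-- `V^s(D) = ⋂_{δ>0} {x ∈ W^s(C) : lim_{i→∞} d(f^i(x), f^i(D_δ)) = 0}`, where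
`D_δ` is the unique element of `𝒟(C,δ)` containing `D`. -/
def vStable (f : X → X) (C D : Set X) : Set X :=
  {x | x ∈ wStable f C ∧ ∀ δ > 0, ∀ Dd ∈ DClassesd f C δ, D ⊆ Dd →
    Tendsto (fun i => infDist (f^[i] x) (f^[i] '' Dd)) atTop (nhds 0)}

/-- The s-limit shadowing property. -/
def SLimitShadowing (f : X → X) : Prop :=
  ∀ ε > 0, ∃ δ > 0, ∀ x : ℕ → X,
    (∀ i, dist (f (x i)) (x (i + 1)) ≤ δ) →
    Tendsto (fun i => dist (f (x i)) (x (i + 1))) atTop (nhds 0) →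
    ∃ z : X, (∀ i, dist (f^[i] z) (x i) ≤ ε) ∧
      Tendsto (fun i => dist (f^[i] z) (x i)) atTop (nhds 0)

/-- The limit shadowing property. -/
def LimitShadowing (f : X → X) : Prop :=
  ∀ x : ℕ → X, Tendsto (fun i => dist (f (x i)) (x (i + 1))) atTop (nhds 0) →
    ∃ z : X, Tendsto (fun i => dist (f^[i] z) (x i)) atTop (nhds 0)

/-- The (plain) shadowing property. -/
def ShadowingProperty (f : X → X) : Prop :=
  ∀ ε > 0, ∃ δ > 0, ∀ x : ℕ → X, (∀ i, dist (f (x i)) (x (i + 1)) ≤ δ) →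
    ∃ z : X, ∀ i, dist (f^[i] z) (x i) ≤ ε

/-- A Furstenberg family: hereditary upward and proper. -/
def FurstenbergFamily (F : Set (Set ℕ)) : Prop :=
  (∀ A B : Set ℕ, A ∈ F → A ⊆ B → B ∈ F) ∧ F.Nonempty ∧ F ≠ Set.univ

/-- A full Furstenberg family. -/
def FullFamily (F : Set (Set ℕ)) : Prop :=
  ∀ A ∈ F, ∀ n : ℕ, {i ∈ A | n ≤ i} ∈ F

/-- A translation invariant Furstenberg family. -/
def TranslationInvariantFamily (F : Set (Set ℕ)) : Prop :=
  ∀ A ∈ F, ∀ n : ℕ, ((fun i => i + n) '' A ∈ F ∧ {i | i + n ∈ A} ∈ F)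

/-- `S_f(x₁,…,xₙ; r) = {i : min_{j<k} d(fⁱ(x_j), fⁱ(x_k)) > r}`. -/
def Sset (f : X → X) {n : ℕ} (x : Fin n → X) (r : ℝ) : Set ℕ :=
  {i | ∀ j k : Fin n, j < k → r < dist (f^[i] (x j)) (f^[i] (x k))}

/-- `T_f(x₁,…,xₙ; r) = {i : max_{j<k} d(fⁱ(x_j), fⁱ(x_k)) < r}`. -/
def Tset (f : X → X) {n : ℕ} (x : Fin n → X) (r : ℝ) : Set ℕ :=
  {i | ∀ j k : Fin n, j < k → dist (f^[i] (x j)) (f^[i] (x k)) < r}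

/-- `(x₁,…,xₙ)` is an `(ℱ,𝒢)`-δ-scrambled n-tuple for `f`. -/
def Scrambled (f : X → X) (F G : Set (Set ℕ)) (δ : ℝ) {n : ℕ} (x : Fin n → X) : Prop :=
  Sset f x δ ∈ F ∧ ∀ ε > 0, Tset f x ε ∈ G

/-- `Y` is dense `(ℱ,𝒢)`-n-δ-chaotic for `f`: the `(ℱ,𝒢)`-δ-scrambled n-tuples in `Yⁿ`
form a dense subset of `Yⁿ`. -/
def DenseChaotic (f : X → X) (F G : Set (Set ℕ)) (n : ℕ) (δ : ℝ) (Y : Set X) : Prop :=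
  {x : Fin n → X | ∀ j, x j ∈ Y} ⊆
    closure {x : Fin n → X | (∀ j, x j ∈ Y) ∧ Scrambled f F G δ x}

/-- `S` is a residual subset of the subspace `T`: it contains a countable intersection of
dense open subsets of `T`. -/
def ResidualIn {α : Type*} [TopologicalSpace α] (T S : Set α) : Prop :=
  ∃ U : ℕ → Set α, (∀ i, IsOpen (U i)) ∧ (∀ i, T ⊆ closure (U i ∩ T)) ∧
    (⋂ i, U i) ∩ T ⊆ S

/-- `Y` is generic `(ℱ,𝒢)`-n-δ-chaotic for `f`: the `(ℱ,𝒢)`-δ-scrambled n-tuples in `Yⁿ`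
form a residual subset of `Yⁿ`. -/
def GenericChaotic (f : X → X) (F G : Set (Set ℕ)) (n : ℕ) (δ : ℝ) (Y : Set X) : Prop :=
  ResidualIn {x : Fin n → X | ∀ j, x j ∈ Y}
    {x : Fin n → X | (∀ j, x j ∈ Y) ∧ Scrambled f F G δ x}

/-- A Furstenberg family `F` is compatible with `(Z, g)`. -/
def CompatibleFamily {Z : Type*} [TopologicalSpace Z] (F : Set (Set ℕ)) (g : Z → Z) : Prop :=
  ∀ U : Set Z, IsOpen U → IsGδ {z | {i | g^[i] z ∈ U} ∈ F}

end Defs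

section Chains

variable {X : Type*} [MetricSpace X] {f : X → X} {C : Set X} {δ ε : ℝ} {k l : ℕ} {x y z p : X}

lemma ChainIn.mono (h : ChainIn f C δ k x y) (hle : δ ≤ ε) : ChainIn f C ε k x y := by
  obtain ⟨hk, c, h0, h1, hC, hd⟩ := h
  exact ⟨hk, c, h0, h1, hC, fun i hi => (hd i hi).trans hle⟩

lemma ChainIn.trans (h : ChainIn f C δ k x y) (h' : ChainIn f C δ l y z) :
    ChainIn f C δ (k + l) x z := by
  obtain ⟨hk, c, h0, h1, hC, hd⟩ := h
  obtain ⟨hl, e, g0, g1, gC, gd⟩ := h'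
  refine ⟨by omega, fun i => if i ≤ k then c i else e (i - k), by simpa using h0, ?_, ?_, ?_⟩
  · simpa [show ¬ l = 0 by omega] using g1
  · intro i hi
    by_cases h : i ≤ k
    · simpa [h] using hC i h
    · simpa [h] using gC (i - k) (by omega)
  · intro i hi
    rcases lt_trichotomy i k with h | rfl | h
    · simpa [h.le, Nat.succ_le_of_lt h] using hd i h
    · simpa [h1, ← g0] using gd 0 (by omega)
    · have := gd (i - k) (by omega)
      rw [show i - k + 1 = i + 1 - k by omega] at this
      simpa [show ¬ i ≤ k by omega, show ¬ i + 1 ≤ k by omega] using this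

/-- A segment `c i, …, c j` of a chain is a chain. -/
lemma chainIn_segment {c : ℕ → X} (hC : ∀ i ≤ k, c i ∈ C)
    (hd : ∀ i < k, dist (f (c i)) (c (i + 1)) ≤ δ) {i j : ℕ} (hij : i < j) (hj : j ≤ k) :
    ChainIn f C δ (j - i) (c i) (c j) := by
  refine ⟨by omega, fun n => c (i + n), rfl, ?_, fun n hn => hC _ (by omega),
    fun n hn => hd _ (by omega)⟩
  change c (i + (j - i)) = c j
  congr 1
  omega

lemma ChainIn.replace_right (h : ChainIn f C δ k x y) (hz : z ∈ C) (hyz : dist y z ≤ ε) :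
    ChainIn f C (δ + ε) k x z := by
  obtain ⟨hk, c, rfl, rfl, hC, hd⟩ := h
  have hε : 0 ≤ ε := dist_nonneg.trans hyz
  refine ⟨hk, Function.update c k z, ?_, by simp, ?_, ?_⟩
  · rw [Function.update_of_ne (by omega)]
  · intro i hi
    by_cases h : i = k
    · simpa [h] using hz
    · simpa [h] using hC i hi
  · intro i hi
    rw [Function.update_of_ne (by omega)]
    by_cases h : i + 1 = k
    · subst h
      simpa using (dist_triangle _ _ _).trans (add_le_add (hd i hi) hyz)
    · rw [Function.update_of_ne h]
      linarith [hd i hi]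

lemma ChainIn.replace_left (h : ChainIn f C δ k x y) (hz : z ∈ C) (hzx : dist (f z) (f x) ≤ ε) :
    ChainIn f C (δ + ε) k z y := by
  obtain ⟨hk, c, rfl, rfl, hC, hd⟩ := h
  have hε : 0 ≤ ε := dist_nonneg.trans hzx
  refine ⟨hk, Function.update c 0 z, by simp, ?_, ?_, ?_⟩
  · rw [Function.update_of_ne (by omega)]
  · intro i hi
    by_cases h : i = 0
    · simpa [h] using hz
    · simpa [h] using hC i hi
  · intro i hi
    rw [Function.update_of_ne (by omega : i + 1 ≠ 0)]
    by_cases h : i = 0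
    · subst h
      simp only [Function.update_self]
      linarith [dist_triangle (f z) (f (c 0)) (c (0 + 1)), hd 0 hi]
    · rw [Function.update_of_ne h]
      linarith [hd i hi]

lemma ChainReach.trans (h : ChainReach f x y) (h' : ChainReach f y z) : ChainReach f x z := by
  intro δ hδ
  obtain ⟨k, hk⟩ := h δ hδ
  obtain ⟨l, hl⟩ := h' δ hδ
  exact ⟨k + l, hk.trans hl⟩

lemma IsChainComponent.mem_iff (hC : IsChainComponent f C) (hx : x ∈ C) :
    p ∈ C ↔ ChainReach f x p ∧ ChainReach f p x := by
  obtain ⟨w, hw, rfl⟩ := hC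
  obtain ⟨-, hwx, hxw⟩ := hx
  constructor
  · rintro ⟨-, hwp, hpw⟩
    exact ⟨hxw.trans hwp, hpw.trans hwx⟩
  · rintro ⟨hxp, hpx⟩
    exact ⟨hpx.trans hxp, hwx.trans hxp, hpx.trans hxw⟩

lemma IsChainComponent.mem_of_tendsto (hf : Continuous f) (hC : IsChainComponent f C)
    (hx : x ∈ C) {u : ℕ → ℝ} (hu : Tendsto u atTop (𝓝 0)) {q : ℕ → X}
    (hq : Tendsto q atTop (𝓝 p)) (hxq : ∀ n, ∃ k, ChainIn f univ (u n) k x (q n))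
    (hqx : ∀ n, ∃ k, ChainIn f univ (u n) k (q n) x) : p ∈ C := by
  rw [hC.mem_iff hx]
  constructor
  · intro ε hε
    obtain ⟨n, hn, hn'⟩ := ((hu.eventually_lt_const (half_pos hε)).and
      (Metric.tendsto_nhds.1 hq _ (half_pos hε))).exists
    obtain ⟨k, hk⟩ := hxq n
    exact ⟨k, (hk.replace_right (mem_univ p) hn'.le).mono (by linarith)⟩
  · intro ε hε
    obtain ⟨n, hn, hn'⟩ := ((hu.eventually_lt_const (half_pos hε)).and
      (Metric.tendsto_nhds.1 ((hf.tendsto p).comp hq) _ (half_pos hε))).exists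
    obtain ⟨k, hk⟩ := hqx n
    rw [dist_comm] at hn'
    exact ⟨k, (hk.replace_left (mem_univ p) hn'.le).mono (by linarith)⟩

/-- Points lying on cycles through `x` with small jumps are close to the chain component of `x`. -/
lemma IsChainComponent.exists_near [CompactSpace X] (hf : Continuous f)
    (hC : IsChainComponent f C) (hx : x ∈ C) (hε : 0 < ε) :
    ∃ η > 0, ∀ p, (∃ k, ChainIn f univ η k x p) → (∃ k, ChainIn f univ η k p x) →
      ∃ q ∈ C, dist p q < ε := by
  by_contra! hcon
  choose q hxq hqx hfar using fun n : ℕ => hcon (1 / ((n : ℝ) + 1)) Nat.one_div_pos_of_nat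
  obtain ⟨p, φ, hφ, hp⟩ := CompactSpace.tendsto_subseq q
  have hpC : p ∈ C := hC.mem_of_tendsto hf hx
    (tendsto_one_div_add_atTop_nhds_zero_nat.comp hφ.tendsto_atTop) hp
    (fun n => hxq (φ n)) (fun n => hqx (φ n))
  obtain ⟨n, hn⟩ := (Metric.tendsto_nhds.1 hp _ hε).exists
  exact absurd hn (not_lt.2 (hfar (φ n) p hpC))

lemma IsChainComponent.exists_chainIn [CompactSpace X] (hf : Continuous f)
    (hC : IsChainComponent f C) (hx : x ∈ C) (hy : y ∈ C) (hδ : 0 < δ) :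
    ∃ k, ChainIn f C δ k x y := by
  obtain ⟨θ, hθ, hfθ⟩ := Metric.uniformContinuous_iff.1
    (CompactSpace.uniformContinuous_of_continuous hf) (δ / 3) (by linarith)
  obtain ⟨η, hη, hnear⟩ := hC.exists_near hf hx (ε := min θ (δ / 3)) (by positivity)
  obtain ⟨hxy, hyx⟩ := (hC.mem_iff hx).1 hy
  obtain ⟨k, hk, c, rfl, rfl, hcC, hd⟩ := hxy (min η (δ / 3)) (by positivity)
  obtain ⟨l, hl⟩ := hyx η hη
  have hdη : ∀ i < k, dist (f (c i)) (c (i + 1)) ≤ η := fun i hi =>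
    (hd i hi).trans (min_le_left _ _)
  have key : ∀ i, ∃ q, i ≤ k → q ∈ C ∧ dist (c i) q < min θ (δ / 3) ∧
      (i = 0 ∨ i = k → q = c i) := by
    intro i
    by_cases hend : i = 0 ∨ i = k
    · refine ⟨c i, fun _ => ⟨?_, by rw [dist_self]; positivity, fun _ => rfl⟩⟩
      rcases hend with rfl | rfl <;> assumption
    · by_cases hik : i ≤ k
      · obtain ⟨q, hq, hcq⟩ := hnear (c i)
          ⟨_, chainIn_segment hcC hdη (by omega) hik⟩
          ⟨_, (chainIn_segment hcC hdη (by omega : i < k) le_rfl).trans hl⟩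
        exact ⟨q, fun _ => ⟨hq, hcq, fun h => absurd h hend⟩⟩
      · exact ⟨c i, fun h => absurd h hik⟩
  choose q hq using key
  refine ⟨k, hk, q, (hq 0 (by omega)).2.2 (.inl rfl), (hq k le_rfl).2.2 (.inr rfl),
    fun i hi => (hq i hi).1, fun i hi => ?_⟩
  have h1 : dist (f (q i)) (f (c i)) < δ / 3 := by
    refine hfθ ?_
    rw [dist_comm]
    exact (hq i hi.le).2.1.trans_le (min_le_left _ _)
  have h2 := (hd i hi).trans (min_le_right _ _)
  have h3 := (hq (i + 1) hi).2.1.trans_le (min_le_right _ _)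
  linarith [dist_triangle4 (f (q i)) (f (c i)) (c (i + 1)) (q (i + 1))]

lemma IsChainComponent.mapsTo (hf : Continuous f) (hC : IsChainComponent f C) :
    MapsTo f C C := by
  intro x hx
  rw [hC.mem_iff hx]
  have hxx := ((hC.mem_iff hx).1 hx).1
  constructor
  · intro ε hε
    refine ⟨1, le_rfl, fun i => f^[i] x, rfl, rfl, fun _ _ => mem_univ _, fun i _ => ?_⟩
    simpa [← Function.iterate_succ_apply' f] using hε.le
  · intro ε hε
    obtain ⟨θ, hθ, hfθ⟩ := Metric.continuousAt_iff.1 (hf.continuousAt (x := f x)) (ε / 2)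
      (half_pos hε)
    obtain ⟨k, hk⟩ := hxx (min (θ / 2) (ε / 2)) (by positivity)
    obtain ⟨-, c, h0, h1, hcC, hd⟩ := hk.trans hk
    have hk1 := hk.1
    have hseg := chainIn_segment hcC hd (by omega : 1 < k + k) le_rfl
    rw [h1] at hseg
    have hd0 := hd 0 (by omega)
    rw [h0, dist_comm] at hd0
    have hclose : dist (f (c 1)) (f (f x)) < ε / 2 :=
      hfθ (hd0.trans_lt ((min_le_left _ _).trans_lt (half_lt_self hθ)))
    rw [dist_comm] at hclose
    exact ⟨_, (hseg.replace_left (mem_univ (f x)) hclose.le).mono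
      (by linarith [min_le_right (θ / 2) (ε / 2)])⟩

lemma IsChainComponent.surjOn [CompactSpace X] (hf : Continuous f)
    (hC : IsChainComponent f C) : SurjOn f C C := by
  intro x hx
  have hxx := ((hC.mem_iff hx).1 hx).1
  have key : ∀ n : ℕ, ∃ q, (∃ k, ChainIn f univ (1 / ((n : ℝ) + 1)) k x q) ∧
      (∃ k, ChainIn f univ (1 / ((n : ℝ) + 1)) k q x) ∧ dist (f q) x ≤ 1 / ((n : ℝ) + 1) := by
    intro n
    obtain ⟨k, hk⟩ := hxx (1 / ((n : ℝ) + 1)) Nat.one_div_pos_of_nat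
    obtain ⟨-, c, h0, h1, hcC, hd⟩ := hk.trans hk
    have hk1 := hk.1
    have hlast := hd (k + k - 1) (by omega)
    rw [show k + k - 1 + 1 = k + k by omega, h1] at hlast
    have hto := chainIn_segment hcC hd (by omega : 0 < k + k - 1) (by omega)
    have hfrom := chainIn_segment hcC hd (by omega : k + k - 1 < k + k) le_rfl
    rw [h0] at hto
    rw [h1] at hfrom
    exact ⟨c (k + k - 1), ⟨_, hto⟩, ⟨_, hfrom⟩, hlast⟩
  choose q hxq hqx hfq using key
  obtain ⟨p, φ, hφ, hp⟩ := CompactSpace.tendsto_subseq q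
  have hu := tendsto_one_div_add_atTop_nhds_zero_nat (𝕜 := ℝ) |>.comp hφ.tendsto_atTop
  refine ⟨p, hC.mem_of_tendsto hf hx hu hp (fun n => hxq (φ n)) (fun n => hqx (φ n)), ?_⟩
  exact tendsto_nhds_unique ((hf.tendsto p).comp hp)
    (tendsto_iff_dist_tendsto_zero.2
      (squeeze_zero (fun _ => dist_nonneg) (fun n => hfq (φ n)) hu))

lemma setGcd_dvd {S : Set ℕ} (hS : ∃ n ∈ S, 1 ≤ n) (hk : k ∈ S) : setGcd S ∣ k := by
  obtain ⟨n, hn, hn1⟩ := hS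
  exact Nat.sSup_mem (s := {d | ∀ k ∈ S, d ∣ k}) ⟨1, fun _ _ => one_dvd _⟩
    ⟨n, fun d hd => Nat.le_of_dvd hn1 (hd n hn)⟩ k hk

lemma ChainIn.setGcd_dvd (h : ChainIn f C δ k x x) : setGcd (cycleLengths f C δ) ∣ k := by
  have hx : x ∈ C := by
    obtain ⟨-, c, h0, -, hc, -⟩ := h
    exact h0 ▸ hc 0 (Nat.zero_le _)
  exact _root_.setGcd_dvd ⟨k, ⟨x, hx, h⟩, h.1⟩ ⟨x, hx, h⟩

/-- The ends of two chains of equal length with the same start are equivalent as soon as the first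
end can be joined back to the start. -/
lemma simCd_of_chainIn (hx : ChainIn f C δ k z x) (hy : ChainIn f C δ k z y)
    (hback : ∃ l, ChainIn f C δ l x z) : SimCd f C δ x y := by
  obtain ⟨l, hl⟩ := hback
  exact ⟨l + k, (hl.trans hx).setGcd_dvd, hl.trans hy⟩

lemma chainIn_one (hx : x ∈ C) (hy : y ∈ C) (h : dist (f x) y ≤ δ) : ChainIn f C δ 1 x y := by
  refine ⟨le_rfl, fun i => if i = 0 then x else y, by simp, by simp, fun i _ => ?_, fun i hi => ?_⟩
  · by_cases h : i = 0 <;> simpa [h]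
  · obtain rfl : i = 0 := by omega
    simpa using h

lemma chainIn_iterate (hC : MapsTo f C C) (hδ : 0 ≤ δ) (hx : x ∈ C) (hk : 1 ≤ k) :
    ChainIn f C δ k x (f^[k] x) :=
  ⟨hk, fun i => f^[i] x, rfl, rfl, fun i _ => hC.iterate i hx, fun i _ => by
    simpa only [Function.iterate_succ_apply', dist_self] using hδ⟩

end Chains

/-- property (P2): points of `C` at distance `≤ δ` are `∼_{C,δ}`-equivalent;
consequently, along any δ-chain of `g = f|_C`, `g(xᵢ) ∼_{C,δ} x_{i+1}` and
`xᵢ ∼_{C,δ} gⁱ(x₀)`. -/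
theorem simCd_of_close_and_along_chains
    {X : Type*} [MetricSpace X] [CompactSpace X] (f : X → X) (hf : Continuous f)
    (C : Set X) (hC : IsChainComponent f C) (δ : ℝ) (hδ : 0 < δ) :
    (∀ x ∈ C, ∀ y ∈ C, dist x y ≤ δ → SimCd f C δ x y) ∧
    (∀ (k : ℕ) (c : ℕ → X), 1 ≤ k → (∀ i ≤ k, c i ∈ C) →
      (∀ i < k, dist (f (c i)) (c (i + 1)) ≤ δ) →
      (∀ i < k, SimCd f C δ (f (c i)) (c (i + 1))) ∧
      (∀ i ≤ k, SimCd f C δ (c i) (f^[i] (c 0)))) := by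
  have hmaps := hC.mapsTo hf
  have hclose : ∀ x ∈ C, ∀ y ∈ C, dist x y ≤ δ → SimCd f C δ x y := by
    intro x hx y hy hxy
    obtain ⟨z, hz, rfl⟩ := hC.surjOn hf hx
    exact simCd_of_chainIn (chainIn_one hz hx (by simpa using hδ.le)) (chainIn_one hz hy hxy)
      (hC.exists_chainIn hf hx hz hδ)
  refine ⟨hclose, fun k c _ hcC hd =>
    ⟨fun i hi => hclose _ (hmaps (hcC i hi.le)) _ (hcC _ hi) (hd i hi), fun i hi => ?_⟩⟩
  have h0 := hcC 0 (Nat.zero_le _)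
  rcases Nat.eq_zero_or_pos i with rfl | hi0
  · exact hclose _ h0 _ h0 (by simpa using hδ.le)
  · exact simCd_of_chainIn (chainIn_segment hcC hd hi0 hi) (chainIn_iterate hmaps hδ.le h0 hi0)
      (hC.exists_chainIn hf (hcC i hi) h0 hδ)
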